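/- (DAgger-style update, performance bound.) Let π_n, π_{n+1}, η_n be policies with E_{s∼d_{π_n}}[D_TV(π_{n+1}(·|s), π_n(·|s))] ≤ β for some β ≥ 0. Fix a selection a*(s) ∈ argmin_{a∈A} A^{η_n}(s,a) for each state s, and suppose E_{s∼d_{π_n}}[E_{a∼π_{n+1}(·|s)}[1(a ≠ a*(s))]] ≤ ε_n. Define ε' = max_{s,a} A^{η_n}(s,a), ε = max_{s∈S} |E_{a∼π_{n+1}(·|s)}[A^{η_n}(s,a)]|, Δ = J(π_n) − J(η_n), and assume ε' ≥ 0 and A^{η_n}(s, a*(s)) ≤ 0 for every s. Then J(π_{n+1}) − J(π_n) ≤ 2βε/(1−γ)² + ε'·ε_n/(1−γ) − Δ. -/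

import Mathlib

open scoped BigOperators

noncomputable section

/-- `p` is a probability distribution on a finite type. -/
def IsDist {X : Type*} [Fintype X] (p : X → ℝ) : Prop :=
  (∀ x, 0 ≤ p x) ∧ ∑ x, p x = 1

/-- `P` is a transition dynamics: `P s a` is a distribution over next states. -/
def IsDynamics {S A : Type*} [Fintype S] (P : S → A → S → ℝ) : Prop :=
  ∀ s a, IsDist (P s a)

/-- `π` is a (stochastic) policy: `π s` is a distribution over actions. -/
def IsPolicy {S A : Type*} [Fintype A] (π : S → A → ℝ) : Prop :=
  ∀ s, IsDist (π s)

/-- One-step evolution of a state distribution under policy `π` and dynamics `P`. -/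
def step {S A : Type*} [Fintype S] [Fintype A]
    (P : S → A → S → ℝ) (π : S → A → ℝ) (d : S → ℝ) : S → ℝ :=
  fun s' => ∑ s, ∑ a, d s * π s a * P s a s'

/-- The time-`t` state distribution `d_π^t` starting from `ρ₀`. -/
def stateDist {S A : Type*} [Fintype S] [Fintype A]
    (P : S → A → S → ℝ) (π : S → A → ℝ) (ρ₀ : S → ℝ) : ℕ → S → ℝ
  | 0 => ρ₀
  | t + 1 => step P π (stateDist P π ρ₀ t)

/-- Discounted state visitation distribution `d_π = (1-γ) Σ_t γ^t d_π^t`. -/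
def visit {S A : Type*} [Fintype S] [Fintype A]
    (γ : ℝ) (P : S → A → S → ℝ) (π : S → A → ℝ) (ρ₀ : S → ℝ) : S → ℝ :=
  fun s => (1 - γ) * ∑' t : ℕ, γ ^ t * stateDist P π ρ₀ t s

/-- Expected cost of one step when the state is distributed as `d` and actions follow `π`. -/
def expCost {S A : Type*} [Fintype S] [Fintype A]
    (c : S → A → ℝ) (π : S → A → ℝ) (d : S → ℝ) : ℝ :=
  ∑ s, ∑ a, d s * π s a * c s a

/-- Value function `V^π(s₀)`: expected total discounted cost starting at `s₀`. -/
def Vf {S A : Type*} [Fintype S] [Fintype A] [DecidableEq S]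
    (γ : ℝ) (P : S → A → S → ℝ) (c : S → A → ℝ) (π : S → A → ℝ) (s₀ : S) : ℝ :=
  ∑' t : ℕ, γ ^ t * expCost c π (stateDist P π (fun s => if s = s₀ then 1 else 0) t)

/-- Objective `J(π) = E_{s∼ρ₀}[V^π(s)]`. -/
def Jf {S A : Type*} [Fintype S] [Fintype A] [DecidableEq S]
    (γ : ℝ) (P : S → A → S → ℝ) (c : S → A → ℝ) (ρ₀ : S → ℝ) (π : S → A → ℝ) : ℝ :=
  ∑ s, ρ₀ s * Vf γ P c π s

/-- State-action value `Q^π(s,a) = c(s,a) + γ E_{s'∼P_{s,a}}[V^π(s')]`. -/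
def Qf {S A : Type*} [Fintype S] [Fintype A] [DecidableEq S]
    (γ : ℝ) (P : S → A → S → ℝ) (c : S → A → ℝ) (π : S → A → ℝ) (s : S) (a : A) : ℝ :=
  c s a + γ * ∑ s', P s a s' * Vf γ P c π s'

/-- Disadvantage function `A^π(s,a) = Q^π(s,a) - V^π(s)`. -/
def Adv {S A : Type*} [Fintype S] [Fintype A] [DecidableEq S]
    (γ : ℝ) (P : S → A → S → ℝ) (c : S → A → ℝ) (π : S → A → ℝ) (s : S) (a : A) : ℝ :=
  Qf γ P c π s a - Vf γ P c π s

theorem IsDist.le_one {X : Type*} [Fintype X] {p : X → ℝ} (hp : IsDist p) (x : X) : p x ≤ 1 :=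
  hp.2 ▸ Finset.single_le_sum (fun y _ => hp.1 y) (Finset.mem_univ x)

section MDP

variable {S A : Type*} [Fintype S] [Fintype A]
  {γ : ℝ} {P : S → A → S → ℝ} {c : S → A → ℝ} {ρ₀ : S → ℝ} {π π' : S → A → ℝ}

/-- Pairing the evolved distribution with a test function. -/
theorem sum_step_mul (P : S → A → S → ℝ) (π : S → A → ℝ) (d f : S → ℝ) :
    ∑ s', step P π d s' * f s' = ∑ s, d s * ∑ a, π s a * ∑ s', P s a s' * f s' := by
  simp only [step, Finset.sum_mul, Finset.mul_sum]
  rw [Finset.sum_comm]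
  refine Finset.sum_congr rfl fun s _ => ?_
  rw [Finset.sum_comm]
  exact Finset.sum_congr rfl fun a _ => Finset.sum_congr rfl fun s' _ => by ring

theorem IsDist.step (hP : IsDynamics P) (hπ : IsPolicy π) {d : S → ℝ} (hd : IsDist d) :
    IsDist (step P π d) := by
  refine ⟨fun s' => Finset.sum_nonneg fun s _ => Finset.sum_nonneg fun a _ =>
    mul_nonneg (mul_nonneg (hd.1 s) ((hπ s).1 a)) ((hP s a).1 s'), ?_⟩
  have h := sum_step_mul P π d (fun _ => 1)
  simpa [(hP _ _).2, (hπ _).2, hd.2] using h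

theorem isDist_stateDist (hP : IsDynamics P) (hπ : IsPolicy π) (hρ : IsDist ρ₀) (t : ℕ) :
    IsDist (stateDist P π ρ₀ t) := by
  induction t with
  | zero => exact hρ
  | succ t ih => exact ih.step hP hπ

theorem summable_discounted_stateDist (hγ : 0 ≤ γ) (hγ' : γ < 1) (hP : IsDynamics P)
    (hπ : IsPolicy π) (hρ : IsDist ρ₀) (s : S) :
    Summable fun t : ℕ => γ ^ t * stateDist P π ρ₀ t s := by
  refine Summable.of_nonneg_of_le (fun t => ?_) (fun t => ?_)
    (summable_geometric_of_lt_one hγ hγ')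
  · exact mul_nonneg (pow_nonneg hγ t) ((isDist_stateDist hP hπ hρ t).1 s)
  · exact mul_le_of_le_one_right (pow_nonneg hγ t) ((isDist_stateDist hP hπ hρ t).le_one s)

theorem visit_nonneg (hγ : 0 ≤ γ) (hγ' : γ < 1) (hP : IsDynamics P)
    (hπ : IsPolicy π) (hρ : IsDist ρ₀) (s : S) : 0 ≤ visit γ P π ρ₀ s :=
  mul_nonneg (by linarith) (tsum_nonneg fun t =>
    mul_nonneg (pow_nonneg hγ t) ((isDist_stateDist hP hπ hρ t).1 s))

/-- Stationarity (Bellman flow) equation of the discounted visitation distribution. -/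
theorem visit_eq_add_step (hγ : 0 ≤ γ) (hγ' : γ < 1) (hP : IsDynamics P)
    (hπ : IsPolicy π) (hρ : IsDist ρ₀) (s' : S) :
    visit γ P π ρ₀ s' = (1 - γ) * ρ₀ s' + γ * step P π (visit γ P π ρ₀) s' := by
  have hsum := summable_discounted_stateDist hγ hγ' hP hπ hρ
  have key : HasSum (fun t : ℕ => γ ^ (t + 1) * stateDist P π ρ₀ (t + 1) s')
      (γ * ∑ s, ∑ a, (∑' t : ℕ, γ ^ t * stateDist P π ρ₀ t s) * π s a * P s a s') := by
    have h : HasSum (fun t : ℕ =>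
        γ * ∑ s, ∑ a, γ ^ t * stateDist P π ρ₀ t s * π s a * P s a s')
        (γ * ∑ s, ∑ a, (∑' t : ℕ, γ ^ t * stateDist P π ρ₀ t s) * π s a * P s a s') :=
      (hasSum_sum fun s _ => hasSum_sum fun a _ =>
        (((hsum s).hasSum.mul_right _).mul_right _)).mul_left γ
    convert h using 2 with t
    simp only [stateDist, step, Finset.mul_sum]
    exact Finset.sum_congr rfl fun s _ => Finset.sum_congr rfl fun a _ => by ring
  have hstep : step P π (visit γ P π ρ₀) s' = (1 - γ) *
      ∑ s, ∑ a, (∑' t : ℕ, γ ^ t * stateDist P π ρ₀ t s) * π s a * P s a s' := by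
    simp only [step, visit, Finset.mul_sum, mul_assoc]
  rw [hstep, visit, (hsum s').tsum_eq_zero_add, key.tsum_eq]
  simp only [stateDist, pow_zero]
  ring

theorem stateDist_eq_sum_dirac [DecidableEq S] (P : S → A → S → ℝ) (π : S → A → ℝ)
    (ρ₀ : S → ℝ) (t : ℕ) (s : S) :
    stateDist P π ρ₀ t s =
      ∑ s₀, ρ₀ s₀ * stateDist P π (fun x => if x = s₀ then 1 else 0) t s := by
  induction t generalizing s with
  | zero => simp [stateDist]
  | succ t ih =>
    simp only [stateDist, step, ih, Finset.mul_sum, Finset.sum_mul]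
    conv_rhs => rw [Finset.sum_comm]
    refine Finset.sum_congr rfl fun x _ => ?_
    conv_rhs => rw [Finset.sum_comm]
    exact Finset.sum_congr rfl fun a _ => Finset.sum_congr rfl fun s₀ _ => by ring

theorem isDist_dirac [DecidableEq S] (s₀ : S) :
    IsDist (fun x : S => if x = s₀ then (1 : ℝ) else 0) :=
  ⟨fun x => by dsimp only; split_ifs <;> norm_num, by simp⟩

/-- The objective is the expected cost under the discounted visitation distribution. -/
theorem one_sub_mul_Jf [DecidableEq S] (hγ : 0 ≤ γ) (hγ' : γ < 1) (hP : IsDynamics P)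
    (hπ : IsPolicy π) (hρ : IsDist ρ₀) :
    (1 - γ) * Jf γ P c ρ₀ π = expCost c π (visit γ P π ρ₀) := by
  have hcost : ∀ ρ : S → ℝ, IsDist ρ →
      HasSum (fun t : ℕ => γ ^ t * expCost c π (stateDist P π ρ t))
        (∑ s, ∑ a, (∑' t : ℕ, γ ^ t * stateDist P π ρ t s) * π s a * c s a) := by
    intro ρ h
    have h' : HasSum (fun t : ℕ => ∑ s, ∑ a, γ ^ t * stateDist P π ρ t s * π s a * c s a)
        (∑ s, ∑ a, (∑' t : ℕ, γ ^ t * stateDist P π ρ t s) * π s a * c s a) :=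
      hasSum_sum fun s _ => hasSum_sum fun a _ =>
        (((summable_discounted_stateDist hγ hγ' hP hπ h s).hasSum.mul_right _).mul_right _)
    convert h' using 2 with t
    simp only [expCost, Finset.mul_sum, mul_assoc]
  have hJ : HasSum (fun t : ℕ => γ ^ t * expCost c π (stateDist P π ρ₀ t))
      (Jf γ P c ρ₀ π) := by
    have h' : HasSum (fun t : ℕ => ∑ s₀, ρ₀ s₀ * (γ ^ t *
        expCost c π (stateDist P π (fun x => if x = s₀ then 1 else 0) t)))
        (Jf γ P c ρ₀ π) :=
      hasSum_sum fun s₀ _ => (hcost _ (isDist_dirac s₀)).summable.hasSum.mul_left _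
    convert h' using 2 with t
    simp only [expCost, stateDist_eq_sum_dirac P π ρ₀ t, Finset.mul_sum, Finset.sum_mul]
    conv_rhs => rw [Finset.sum_comm]
    refine Finset.sum_congr rfl fun s _ => ?_
    conv_rhs => rw [Finset.sum_comm]
    exact Finset.sum_congr rfl fun a _ => Finset.sum_congr rfl fun s₀ _ => by ring
  rw [hJ.unique (hcost ρ₀ hρ)]
  simp only [expCost, visit, Finset.mul_sum, mul_assoc]

/-- Performance difference lemma. -/
theorem performance_difference [DecidableEq S] (hγ : 0 ≤ γ) (hγ' : γ < 1)
    (hP : IsDynamics P) (hπ : IsPolicy π) (hρ : IsDist ρ₀) (η : S → A → ℝ) :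
    (1 - γ) * (Jf γ P c ρ₀ π - Jf γ P c ρ₀ η) =
      ∑ s, visit γ P π ρ₀ s * ∑ a, π s a * Adv γ P c η s a := by
  set d := visit γ P π ρ₀ with hd
  set V := Vf γ P c η with hV
  have hflow : ∑ s, d s * V s = (1 - γ) * Jf γ P c ρ₀ η +
      γ * ∑ s, d s * ∑ a, π s a * ∑ s', P s a s' * V s' := by
    rw [← sum_step_mul, Jf, Finset.mul_sum, Finset.mul_sum, ← Finset.sum_add_distrib]
    refine Finset.sum_congr rfl fun s _ => ?_
    rw [hd, visit_eq_add_step hγ hγ' hP hπ hρ s]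
    ring
  have hlocal : ∀ s, ∑ a, π s a * Adv γ P c η s a =
      ∑ a, π s a * c s a + γ * ∑ a, π s a * ∑ s', P s a s' * V s' - V s := by
    intro s
    have h : ∑ a, π s a * V s = V s := by rw [← Finset.sum_mul, (hπ s).2, one_mul]
    conv_rhs => rw [← h]
    rw [Finset.mul_sum, ← Finset.sum_add_distrib, ← Finset.sum_sub_distrib]
    exact Finset.sum_congr rfl fun a _ => by simp only [Adv, Qf, ← hV]; ring
  have hsplit : ∑ s, d s * ∑ a, π s a * Adv γ P c η s a = expCost c π d +
      γ * (∑ s, d s * ∑ a, π s a * ∑ s', P s a s' * V s') - ∑ s, d s * V s := by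
    rw [expCost, Finset.mul_sum, ← Finset.sum_add_distrib, ← Finset.sum_sub_distrib]
    refine Finset.sum_congr rfl fun s _ => ?_
    simp only [hlocal, mul_assoc, ← Finset.mul_sum]
    ring
  rw [hsplit, hflow, mul_sub, one_sub_mul_Jf hγ hγ' hP hπ hρ]
  ring

/-- A signed kernel average is bounded in `ℓ¹` by the total mass of the weights. -/
theorem sum_abs_sum_mul_dynamics_le (hP : IsDynamics P) (w : S → A → ℝ) :
    ∑ s', |∑ s, ∑ a, w s a * P s a s'| ≤ ∑ s, ∑ a, |w s a| := by
  calc ∑ s', |∑ s, ∑ a, w s a * P s a s'|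
      ≤ ∑ s', ∑ s, ∑ a, |w s a| * P s a s' := by
        refine Finset.sum_le_sum fun s' _ => (Finset.abs_sum_le_sum_abs _ _).trans
          (Finset.sum_le_sum fun s _ => (Finset.abs_sum_le_sum_abs _ _).trans_eq
            (Finset.sum_congr rfl fun a _ => ?_))
        rw [abs_mul, abs_of_nonneg ((hP s a).1 s')]
    _ = ∑ s, ∑ a, |w s a| := by
        rw [Finset.sum_comm]
        refine Finset.sum_congr rfl fun s _ => ?_
        rw [Finset.sum_comm]
        refine Finset.sum_congr rfl fun a _ => ?_
        rw [← Finset.mul_sum, (hP s a).2, mul_one]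

/-- Visitation distributions are stable under changes of policy, in `ℓ¹`. -/
theorem one_sub_mul_sum_abs_visit_sub_le (hγ : 0 ≤ γ) (hγ' : γ < 1) (hP : IsDynamics P)
    (hπ : IsPolicy π) (hπ' : IsPolicy π') (hρ : IsDist ρ₀) :
    (1 - γ) * ∑ s, |visit γ P π' ρ₀ s - visit γ P π ρ₀ s| ≤
      γ * ∑ s, visit γ P π ρ₀ s * ∑ a, |π' s a - π s a| := by
  set d := visit γ P π ρ₀ with hd
  set d' := visit γ P π' ρ₀ with hd'
  have hdiff : ∀ s', d' s' - d s' =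
      γ * ∑ s, ∑ a, (d' s * π' s a - d s * π s a) * P s a s' := by
    intro s'
    rw [hd, hd', visit_eq_add_step hγ hγ' hP hπ hρ s', visit_eq_add_step hγ hγ' hP hπ' hρ s',
      ← hd, ← hd']
    simp only [step, sub_mul, Finset.sum_sub_distrib]
    ring
  have hw : ∀ s, ∑ a, |d' s * π' s a - d s * π s a| ≤
      |d' s - d s| + d s * ∑ a, |π' s a - π s a| := by
    intro s
    have h : |d' s - d s| = ∑ a, |d' s - d s| * π' s a := by
      rw [← Finset.mul_sum, (hπ' s).2, mul_one]
    rw [h, Finset.mul_sum, ← Finset.sum_add_distrib]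
    refine Finset.sum_le_sum fun a _ => ?_
    have h0 : 0 ≤ d s := visit_nonneg hγ hγ' hP hπ hρ s
    calc |d' s * π' s a - d s * π s a|
        = |(d' s - d s) * π' s a + d s * (π' s a - π s a)| := by ring_nf
      _ ≤ |d' s - d s| * π' s a + d s * |π' s a - π s a| := by
        refine (abs_add_le _ _).trans_eq ?_
        rw [abs_mul, abs_mul, abs_of_nonneg ((hπ' s).1 a), abs_of_nonneg h0]
  have hmain : ∑ s, |d' s - d s| ≤
      γ * (∑ s, |d' s - d s| + ∑ s, d s * ∑ a, |π' s a - π s a|) := by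
    calc ∑ s, |d' s - d s|
        = γ * ∑ s', |∑ s, ∑ a, (d' s * π' s a - d s * π s a) * P s a s'| := by
          rw [Finset.mul_sum]
          refine Finset.sum_congr rfl fun s' _ => ?_
          rw [hdiff s', abs_mul, abs_of_nonneg hγ]
      _ ≤ _ := by
          refine mul_le_mul_of_nonneg_left ?_ hγ
          rw [← Finset.sum_add_distrib]
          exact (sum_abs_sum_mul_dynamics_le hP _).trans (Finset.sum_le_sum fun s _ => hw s)
  linarith

end MDP

/-- **DAgger-style update, performance bound.** Under the same assumptions as the
intermediate bound, with `Δ = J(π_n) - J(η_n)`,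
`J(π_{n+1}) - J(π_n) ≤ 2βε/(1-γ)² + ε'·ε_n/(1-γ) - Δ`. -/
theorem dagger_performance_bound
    {S A : Type*} [Fintype S] [Fintype A] [Nonempty S] [Nonempty A]
    [DecidableEq S] [DecidableEq A]
    (γ : ℝ) (P : S → A → S → ℝ) (c : S → A → ℝ) (ρ₀ : S → ℝ)
    (hγ : 0 < γ) (hγ' : γ < 1) (hP : IsDynamics P) (hρ : IsDist ρ₀)
    (hc : ∀ s a, 0 ≤ c s a ∧ c s a ≤ 1)
    (πn πnext ηn : S → A → ℝ)
    (hπn : IsPolicy πn) (hπnext : IsPolicy πnext) (hηn : IsPolicy ηn)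
    (β εn : ℝ) (hβ : 0 ≤ β) (hεn : 0 ≤ εn)
    (htv : ∑ s, visit γ P πn ρ₀ s * ((∑ a, |πnext s a - πn s a|) / 2) ≤ β)
    (astar : S → A)
    (hastar : ∀ s a, Adv γ P c ηn s (astar s) ≤ Adv γ P c ηn s a)
    (hclass : ∑ s, visit γ P πn ρ₀ s *
      ∑ a, πnext s a * (if a = astar s then (0 : ℝ) else 1) ≤ εn)
    (hε' : 0 ≤ ⨆ s : S, ⨆ a : A, Adv γ P c ηn s a)
    (hneg : ∀ s, Adv γ P c ηn s (astar s) ≤ 0) :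
    Jf γ P c ρ₀ πnext - Jf γ P c ρ₀ πn ≤
      2 * β * (⨆ s : S, |∑ a, πnext s a * Adv γ P c ηn s a|) / (1 - γ) ^ 2 +
        (⨆ s : S, ⨆ a : A, Adv γ P c ηn s a) * εn / (1 - γ) -
        (Jf γ P c ρ₀ πn - Jf γ P c ρ₀ ηn) := by
  set g : S → ℝ := fun s => ∑ a, πnext s a * Adv γ P c ηn s a with hg
  set ε := ⨆ s : S, |∑ a, πnext s a * Adv γ P c ηn s a| with hεdef
  set ε' := ⨆ s : S, ⨆ a : A, Adv γ P c ηn s a with hε'def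
  set d := visit γ P πn ρ₀ with hd
  set d' := visit γ P πnext ρ₀ with hd'
  have hpos : 0 < 1 - γ := by linarith
  have hgε : ∀ s, |g s| ≤ ε := fun s =>
    le_ciSup (f := fun s => |∑ a, πnext s a * Adv γ P c ηn s a|)
      (Set.finite_range _).bddAbove s
  have hAdv : ∀ s a, Adv γ P c ηn s a ≤ ε' := fun s a =>
    (le_ciSup (f := fun a => Adv γ P c ηn s a) (Set.finite_range _).bddAbove a).trans
      (le_ciSup (f := fun s => ⨆ a, Adv γ P c ηn s a) (Set.finite_range _).bddAbove s)
  have hε : 0 ≤ ε := (abs_nonneg _).trans (hgε (Classical.arbitrary S))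
  have hgle : ∀ s, g s ≤ ε' * ∑ a, πnext s a * (if a = astar s then (0 : ℝ) else 1) := by
    intro s
    rw [hg, Finset.mul_sum]
    refine Finset.sum_le_sum fun a _ => ?_
    have h0 := (hπnext s).1 a
    split_ifs with h
    · subst h
      simpa using mul_nonpos_of_nonneg_of_nonpos h0 (hneg s)
    · rw [mul_one, mul_comm ε']
      exact mul_le_mul_of_nonneg_left (hAdv s a) h0
  have hfirst : ∑ s, d s * g s ≤ ε' * εn := by
    refine le_trans ?_ (mul_le_mul_of_nonneg_left hclass hε')
    rw [Finset.mul_sum]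
    refine Finset.sum_le_sum fun s _ => ?_
    rw [mul_left_comm]
    exact mul_le_mul_of_nonneg_left (hgle s) (visit_nonneg hγ.le hγ' hP hπn hρ s)
  have hTV : ∑ s, d s * ∑ a, |πnext s a - πn s a| ≤ 2 * β := by
    have h : ∑ s, d s * ((∑ a, |πnext s a - πn s a|) / 2) =
        (∑ s, d s * ∑ a, |πnext s a - πn s a|) / 2 := by
      rw [Finset.sum_div]
      exact Finset.sum_congr rfl fun s _ => by ring
    linarith
  have hdist : ∑ s, |d' s - d s| ≤ 2 * β / (1 - γ) := by
    rw [le_div_iff₀ hpos, mul_comm]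
    refine (one_sub_mul_sum_abs_visit_sub_le hγ.le hγ' hP hπn hπnext hρ).trans ?_
    calc γ * ∑ s, d s * ∑ a, |πnext s a - πn s a| ≤ γ * (2 * β) :=
          mul_le_mul_of_nonneg_left hTV hγ.le
      _ ≤ 2 * β := mul_le_of_le_one_left (by linarith) hγ'.le
  have hsecond : ∑ s, (d' s - d s) * g s ≤ 2 * β / (1 - γ) * ε := by
    refine le_trans ?_ (mul_le_mul_of_nonneg_right hdist hε)
    rw [Finset.sum_mul]
    refine Finset.sum_le_sum fun s _ => (le_abs_self _).trans ?_
    rw [abs_mul]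
    exact mul_le_mul_of_nonneg_left (hgε s) (abs_nonneg _)
  have hPD : (1 - γ) * (Jf γ P c ρ₀ πnext - Jf γ P c ρ₀ ηn) =
      ∑ s, (d' s - d s) * g s + ∑ s, d s * g s := by
    rw [performance_difference hγ.le hγ' hP hπnext hρ ηn, ← Finset.sum_add_distrib]
    exact Finset.sum_congr rfl fun s _ => by ring
  have hfinal : Jf γ P c ρ₀ πnext - Jf γ P c ρ₀ ηn ≤
      (2 * β / (1 - γ) * ε + ε' * εn) / (1 - γ) := by
    rw [le_div_iff₀ hpos, mul_comm, hPD]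
    exact add_le_add hsecond hfirst
  have hrw : (2 * β / (1 - γ) * ε + ε' * εn) / (1 - γ) =
      2 * β * ε / (1 - γ) ^ 2 + ε' * εn / (1 - γ) := by
    field_simp
  linarith
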